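/- arXiv:2409.03028 — 3 statements merged into one kernel-verified Lean document; each statement's English description precedes it below -/
import Mathlib

section
/- Let R : ℝ → ℝ³ˣ³ and ω : ℝ → ℝ³ be functions such that R(t) ∈ SO(3) for all t and R is differentiable with R′(t) = R(t)·ω̂(t). Then the attitude error vector e(R(t)) = ½·(R(t) − R(t)ᵀ)^∨ is differentiable in t with derivative d/dt e(R(t)) = E(R(t))·ω(t), where E(R) = ½·(tr(R)·I − Rᵀ). -/
open Matrix

attribute [local instance] Matrix.normedAddCommGroup Matrix.normedSpace

/-- Membership in the special orthogonal group SO(3). -/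
def SO3 (R : Matrix (Fin 3) (Fin 3) ℝ) : Prop :=
  Rᵀ * R = 1 ∧ R * Rᵀ = 1 ∧ R.det = 1

/-- The hat map `ℝ³ → ℝ³ˣ³`, sending a vector to its cross-product matrix. -/
def hat (x : Fin 3 → ℝ) : Matrix (Fin 3) (Fin 3) ℝ :=
  !![0, -x 2, x 1; x 2, 0, -x 0; -x 1, x 0, 0]

/-- The vee map, inverse of the hat map on skew-symmetric matrices. -/
def vee (M : Matrix (Fin 3) (Fin 3) ℝ) : Fin 3 → ℝ :=
  ![M 2 1, M 0 2, M 1 0]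

/-- The attitude error vector `e(R) = ½ (R - Rᵀ)^∨`. -/
noncomputable def attErr (R : Matrix (Fin 3) (Fin 3) ℝ) : Fin 3 → ℝ :=
  (1 / 2 : ℝ) • vee (R - Rᵀ)

/-- `E(R) = ½ (tr(R) I - Rᵀ)`. -/
noncomputable def EMat (R : Matrix (Fin 3) (Fin 3) ℝ) : Matrix (Fin 3) (Fin 3) ℝ :=
  (1 / 2 : ℝ) • (R.trace • (1 : Matrix (Fin 3) (Fin 3) ℝ) - Rᵀ)

/-- The attitude error vector turns right multiplication by `x̂` into the action of `E(R)` on `x`. -/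
theorem attErr_mul_hat (R : Matrix (Fin 3) (Fin 3) ℝ) (x : Fin 3 → ℝ) :
    attErr (R * hat x) = EMat R *ᵥ x := by
  ext i
  fin_cases i <;>
    simp [attErr, vee, hat, EMat, Matrix.mul_apply, Matrix.mulVec, dotProduct, Fin.sum_univ_three,
      Matrix.trace, Matrix.one_apply] <;>
    ring

/-- The attitude error vector is linear in the matrix, so it commutes with differentiation. -/
theorem HasDerivAt.attErr {R : ℝ → Matrix (Fin 3) (Fin 3) ℝ} {R' : Matrix (Fin 3) (Fin 3) ℝ}
    {t : ℝ} (h : HasDerivAt R R' t) :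
    HasDerivAt (fun s => _root_.attErr (R s)) (_root_.attErr R') t := by
  have entry (i j : Fin 3) : HasDerivAt (fun s => R s i j) (R' i j) t :=
    hasDerivAt_pi.1 (hasDerivAt_pi.1 h i) j
  have entry_sub (i j : Fin 3) :
      HasDerivAt (fun s => (1 / 2 : ℝ) * (R s i j - R s j i))
        ((1 / 2 : ℝ) * (R' i j - R' j i)) t :=
    ((entry i j).sub (entry j i)).const_mul _
  refine hasDerivAt_pi.2 fun k => ?_
  fin_cases k
  · exact entry_sub 2 1
  · exact entry_sub 0 2
  · exact entry_sub 1 0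

/-- If `R(t) ∈ SO(3)` and `Ṙ = R ω̂`, then the attitude error vector
`e(R(t)) = ½ (R(t) - R(t)ᵀ)^∨` is differentiable with
`d/dt e(R(t)) = E(R(t)) ω(t)` where `E(R) = ½ (tr(R) I - Rᵀ)`. -/
theorem attErr_hasDerivAt (R : ℝ → Matrix (Fin 3) (Fin 3) ℝ) (ω : ℝ → Fin 3 → ℝ)
    (hSO3 : ∀ t, SO3 (R t))
    (hR : ∀ t, HasDerivAt R (R t * hat (ω t)) t) (t : ℝ) :
    HasDerivAt (fun s => attErr (R s)) (EMat (R t) *ᵥ ω t) t := by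
  rw [← attErr_mul_hat]
  exact (hR t).attErr
end

section
/- Let R : ℝ → ℝ³ˣ³ and ω : ℝ → ℝ³ be functions such that R(t) ∈ SO(3) for all t and R is differentiable with R′(t) = R(t)·ω̂(t). Then the configuration error function Ψ(R(t)) = ½·tr(I − R(t)) is differentiable in t with derivative d/dt Ψ(R(t)) = e(R(t))ᵀ·ω(t), where e(R) = ½·(R − Rᵀ)^∨. -/
open Matrix

attribute [local instance] Matrix.normedAddCommGroup Matrix.normedSpace

/-- The configuration error function `Ψ(R) = ½ tr(I - R)`. -/
noncomputable def Psi (R : Matrix (Fin 3) (Fin 3) ℝ) : ℝ :=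
  (1 / 2 : ℝ) * ((1 : Matrix (Fin 3) (Fin 3) ℝ) - R).trace

theorem attErr_dotProduct (M : Matrix (Fin 3) (Fin 3) ℝ) (x : Fin 3 → ℝ) :
    attErr M ⬝ᵥ x = (1 / 2 : ℝ) * -(M * hat x).trace := by
  simp [attErr, vee, hat, Matrix.trace, Matrix.mul_apply, dotProduct, Fin.sum_univ_three]
  ring

theorem HasDerivAt.matrix_trace {R : ℝ → Matrix (Fin 3) (Fin 3) ℝ}
    {R' : Matrix (Fin 3) (Fin 3) ℝ} {t : ℝ} (h : HasDerivAt R R' t) :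
    HasDerivAt (fun s => (R s).trace) R'.trace t :=
  (LinearMap.toContinuousLinearMap (traceLinearMap (Fin 3) ℝ ℝ)).hasFDerivAt.comp_hasDerivAt t h

/-- If `R(t) ∈ SO(3)` and `Ṙ = R ω̂`, then `Ψ(R(t)) = ½ tr(I - R(t))` is
differentiable with `d/dt Ψ(R(t)) = e(R(t))ᵀ ω(t)`. -/
theorem psi_hasDerivAt (R : ℝ → Matrix (Fin 3) (Fin 3) ℝ) (ω : ℝ → Fin 3 → ℝ)
    (hSO3 : ∀ t, SO3 (R t))
    (hR : ∀ t, HasDerivAt R (R t * hat (ω t)) t) (t : ℝ) :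
    HasDerivAt (fun s => Psi (R s)) (attErr (R t) ⬝ᵥ ω t) t := by
  rw [attErr_dotProduct]
  simp only [Psi, trace_sub]
  exact ((hR t).matrix_trace.const_sub _).const_mul _
end

section
/- For every rotation matrix R ∈ SO(3), the symmetric matrix E(R) + E(R)ᵀ − 2I is negative semidefinite, i.e., vᵀ·(E(R) + E(R)ᵀ − 2I)·v ≤ 0 for all v ∈ ℝ³, where E(R) = ½·(tr(R)·I − Rᵀ). -/
open Matrix

/-- The Cayley–Hamilton expression of the adjugate of a `3 × 3` matrix. -/
theorem adjugate_eq_sq_sub_trace_smul (R : Matrix (Fin 3) (Fin 3) ℝ) :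
    R.adjugate = R * R - R.trace • (1 : Matrix (Fin 3) (Fin 3) ℝ) * R +
      R.adjugate.trace • (1 : Matrix (Fin 3) (Fin 3) ℝ) := by
  rw [adjugate_fin_three]
  ext i j
  fin_cases i <;> fin_cases j <;>
    simp [Matrix.mul_apply, Fin.sum_univ_three, Matrix.trace_fin_three] <;> ring

theorem SO3.adjugate_eq_transpose {R : Matrix (Fin 3) (Fin 3) ℝ} (hR : SO3 R) :
    R.adjugate = Rᵀ := by
  obtain ⟨h₁, -, hdet⟩ := hR
  calc R.adjugate = Rᵀ * R * R.adjugate := by rw [h₁, one_mul]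
    _ = Rᵀ := by rw [Matrix.mul_assoc, mul_adjugate, hdet, one_smul, mul_one]

theorem SO3.sq_eq {R : Matrix (Fin 3) (Fin 3) ℝ} (hR : SO3 R) :
    R * R = R.trace • R - R.trace • (1 : Matrix (Fin 3) (Fin 3) ℝ) + Rᵀ := by
  have h := adjugate_eq_sq_sub_trace_smul R
  rw [hR.adjugate_eq_transpose, trace_transpose, smul_mul_assoc, one_mul] at h
  rw [h]
  abel

theorem SO3.trace_le_three {R : Matrix (Fin 3) (Fin 3) ℝ} (hR : SO3 R) : R.trace ≤ 3 := by
  have hdiag (i : Fin 3) : R i i ≤ 1 := by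
    have h : ∑ j, R i j ^ 2 = 1 := by
      simpa [Matrix.mul_apply, sq] using congrFun (congrFun hR.2.1 i) i
    have hle : R i i ^ 2 ≤ ∑ j, R i j ^ 2 :=
      Finset.single_le_sum (f := fun j => R i j ^ 2) (fun j _ => sq_nonneg _) (Finset.mem_univ i)
    nlinarith [sq_nonneg (R i i - 1)]
  rw [Matrix.trace_fin_three]
  linarith [hdiag 0, hdiag 1, hdiag 2]

/-- Up to scaling, `R + Rᵀ + (1 - tr R) I` is the orthogonal projection onto the rotation axis. -/
theorem SO3.axis_mul_self {R : Matrix (Fin 3) (Fin 3) ℝ} (hR : SO3 R) :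
    (R + Rᵀ + (1 - R.trace) • (1 : Matrix (Fin 3) (Fin 3) ℝ)) *
        (R + Rᵀ + (1 - R.trace) • (1 : Matrix (Fin 3) (Fin 3) ℝ)) =
      (3 - R.trace) • (R + Rᵀ + (1 - R.trace) • (1 : Matrix (Fin 3) (Fin 3) ℝ)) := by
  have hT : Rᵀ * Rᵀ = R.trace • Rᵀ - R.trace • (1 : Matrix (Fin 3) (Fin 3) ℝ) + R := by
    rw [← transpose_mul, hR.sq_eq]
    simp
  simp only [add_mul, mul_add, smul_mul_assoc, mul_smul_comm, one_mul, mul_one, hR.1, hR.2.1,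
    hR.sq_eq, hT]
  module

theorem SO3.axis_nonneg {R : Matrix (Fin 3) (Fin 3) ℝ} (hR : SO3 R) (v : Fin 3 → ℝ) :
    0 ≤ v ⬝ᵥ ((R + Rᵀ + (1 - R.trace) • (1 : Matrix (Fin 3) (Fin 3) ℝ)) *ᵥ v) := by
  have hP := hR.axis_mul_self
  have hsymm : (R + Rᵀ + (1 - R.trace) • (1 : Matrix (Fin 3) (Fin 3) ℝ))ᵀ =
      R + Rᵀ + (1 - R.trace) • (1 : Matrix (Fin 3) (Fin 3) ℝ) := by
    simp [add_comm]
  set P := R + Rᵀ + (1 - R.trace) • (1 : Matrix (Fin 3) (Fin 3) ℝ)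
  have hnorm : (P *ᵥ v) ⬝ᵥ (P *ᵥ v) = (3 - R.trace) * (v ⬝ᵥ (P *ᵥ v)) := by
    rw [← smul_eq_mul, ← dotProduct_smul, ← smul_mulVec, ← hP, ← mulVec_mulVec,
      dotProduct_mulVec v, ← mulVec_transpose, hsymm]
  have hnonneg : 0 ≤ (P *ᵥ v) ⬝ᵥ (P *ᵥ v) := Finset.sum_nonneg fun i _ => mul_self_nonneg _
  rcases hR.trace_le_three.lt_or_eq with hlt | heq
  · exact nonneg_of_mul_nonneg_right (hnorm ▸ hnonneg) (sub_pos.2 hlt)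
  · rw [heq, sub_self, zero_mul, dotProduct_self_eq_zero] at hnorm
    simp [hnorm]

theorem SO3.dotProduct_mulVec_le {R : Matrix (Fin 3) (Fin 3) ℝ} (hR : SO3 R) (v : Fin 3 → ℝ) :
    v ⬝ᵥ (R *ᵥ v) ≤ v ⬝ᵥ v := by
  have hnorm : (R *ᵥ v) ⬝ᵥ (R *ᵥ v) = v ⬝ᵥ v := by
    rw [dotProduct_mulVec, ← mulVec_transpose, mulVec_mulVec, hR.1, one_mulVec]
  have hnonneg : 0 ≤ (R *ᵥ v - v) ⬝ᵥ (R *ᵥ v - v) :=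
    Finset.sum_nonneg fun i _ => mul_self_nonneg _
  rw [sub_dotProduct, dotProduct_sub, dotProduct_sub, hnorm, dotProduct_comm (R *ᵥ v) v] at hnonneg
  linarith

/-- For every `R ∈ SO(3)` the matrix `E(R) + E(R)ᵀ - 2I` is negative semidefinite. -/
theorem EMat_negSemidef (R : Matrix (Fin 3) (Fin 3) ℝ) (hR : SO3 R) (v : Fin 3 → ℝ) :
    v ⬝ᵥ ((EMat R + (EMat R)ᵀ - (2 : ℝ) • (1 : Matrix (Fin 3) (Fin 3) ℝ)) *ᵥ v) ≤ 0 := by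
  have hT : v ⬝ᵥ (Rᵀ *ᵥ v) = v ⬝ᵥ (R *ᵥ v) := by
    rw [mulVec_transpose, dotProduct_comm, ← dotProduct_mulVec]
  have haxis := hR.axis_nonneg v
  have hplane := hR.dotProduct_mulVec_le v
  simp only [EMat, transpose_smul, transpose_sub, transpose_one, transpose_transpose, add_mulVec,
    sub_mulVec, smul_mulVec, one_mulVec, dotProduct_add, dotProduct_sub, dotProduct_smul,
    smul_eq_mul, hT] at haxis ⊢
  linarith
end
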